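/- Let Ω be a bounded domain in ℝ^N with boundary Γ, fix 1 ≤ p ≤ ∞ and ε > 0 such that Ω contains a ball of radius ε, and let g ∈ C(Γ). If x₀ ∈ Γ is a regular point for the Dirichlet-type problem (i.e. it admits a barrier), then the lower and upper Perron solutions attain the boundary value at x₀: u̲^ε(x₀) = u̅^ε(x₀) = g(x₀). -/

import Mathlib

open MeasureTheory Filter Topology Metric
open scoped ENNReal

noncomputable section

/-- The variational `p`-mean predicate: `m` minimizes the (normalized) `L^p` distance of `v`
to constants, with respect to the measure `μ`. -/
def IsPMean {N : ℕ} (p : ℝ≥0∞) (μ : Measure (EuclideanSpace ℝ (Fin N)))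
    (v : EuclideanSpace ℝ (Fin N) → ℝ) (m : ℝ) : Prop :=
  ∀ ν : ℝ, eLpNorm (fun x => v x - m) p μ ≤ eLpNorm (fun x => v x - ν) p μ

/-- The `p`-mean of `v` with respect to `μ` (chosen among the minimizers). -/
def pMean {N : ℕ} (p : ℝ≥0∞) (μ : Measure (EuclideanSpace ℝ (Fin N)))
    (v : EuclideanSpace ℝ (Fin N) → ℝ) : ℝ :=
  Classical.epsilon (IsPMean p μ v)

/-- `r_ε(x) = min (ε, dist(x, ∂Ω))`. -/
def rEps {N : ℕ} (ε : ℝ) (Ω : Set (EuclideanSpace ℝ (Fin N))) (x : EuclideanSpace ℝ (Fin N)) : ℝ :=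
  min ε (Metric.infDist x (frontier Ω))

open Classical in
/-- The operator `μ_p^ε`: the `p`-mean of `v` on the ball `B_{r_ε(x)}(x)` for `x ∈ Ω`,
and `v x` itself outside of `Ω` (in particular on the boundary, where `r_ε = 0`). -/
def muEps {N : ℕ} (p : ℝ≥0∞) (ε : ℝ) (Ω : Set (EuclideanSpace ℝ (Fin N)))
    (v : EuclideanSpace ℝ (Fin N) → ℝ) (x : EuclideanSpace ℝ (Fin N)) : ℝ :=
  if x ∈ Ω then pMean p (volume.restrict (Metric.ball x (rEps ε Ω x))) v else v x

/-- The class `S_g` of variational `p`-subsolutions of the Dirichlet-type problem: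
continuous on `closure Ω`, `v ≤ μ_p^ε[v]` in `Ω`, and `v ≤ g` on `Γ = ∂Ω`. -/
def SgLower {N : ℕ} (p : ℝ≥0∞) (ε : ℝ) (Ω : Set (EuclideanSpace ℝ (Fin N)))
    (g : EuclideanSpace ℝ (Fin N) → ℝ) : Set (EuclideanSpace ℝ (Fin N) → ℝ) :=
  {v | ContinuousOn v (closure Ω) ∧ (∀ x ∈ Ω, v x ≤ muEps p ε Ω v x) ∧
    ∀ x ∈ frontier Ω, v x ≤ g x}

/-- The class `S^g` of variational `p`-supersolutions of the Dirichlet-type problem: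
continuous on `closure Ω`, `v ≥ μ_p^ε[v]` in `Ω`, and `v ≥ g` on `Γ = ∂Ω`. -/
def SgUpper {N : ℕ} (p : ℝ≥0∞) (ε : ℝ) (Ω : Set (EuclideanSpace ℝ (Fin N)))
    (g : EuclideanSpace ℝ (Fin N) → ℝ) : Set (EuclideanSpace ℝ (Fin N) → ℝ) :=
  {v | ContinuousOn v (closure Ω) ∧ (∀ x ∈ Ω, muEps p ε Ω v x ≤ v x) ∧
    ∀ x ∈ frontier Ω, g x ≤ v x}

/-- The lower Perron solution `u̲^ε(x) = sup_{v ∈ S_g} v(x)`. -/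
def lowerPerron {N : ℕ} (p : ℝ≥0∞) (ε : ℝ) (Ω : Set (EuclideanSpace ℝ (Fin N)))
    (g : EuclideanSpace ℝ (Fin N) → ℝ) (x : EuclideanSpace ℝ (Fin N)) : ℝ :=
  sSup ((fun v => v x) '' SgLower p ε Ω g)

/-- The upper Perron solution `u̅^ε(x) = inf_{w ∈ S^g} w(x)`. -/
def upperPerron {N : ℕ} (p : ℝ≥0∞) (ε : ℝ) (Ω : Set (EuclideanSpace ℝ (Fin N)))
    (g : EuclideanSpace ℝ (Fin N) → ℝ) (x : EuclideanSpace ℝ (Fin N)) : ℝ :=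
  sInf ((fun v => v x) '' SgUpper p ε Ω g)

/-- A barrier at `x₀ ∈ Γ` for the Dirichlet-type problem: a continuous function on
`closure Ω`, variationally `p`-superharmonious in `Ω`, positive on `closure Ω ∖ {x₀}`,
vanishing at `x₀`. A boundary point admitting a barrier is called regular. -/
def IsBarrier {N : ℕ} (p : ℝ≥0∞) (ε : ℝ) (Ω : Set (EuclideanSpace ℝ (Fin N)))
    (x₀ : EuclideanSpace ℝ (Fin N)) (w : EuclideanSpace ℝ (Fin N) → ℝ) : Prop :=
  ContinuousOn w (closure Ω) ∧ (∀ x ∈ Ω, muEps p ε Ω w x ≤ w x) ∧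
    (∀ x ∈ closure Ω, x ≠ x₀ → 0 < w x) ∧ w x₀ = 0

/-- A solution of the Dirichlet-type problem `u = μ_p^ε[u]` in `Ω`, `u = g` on `Γ`,
of class `C(closure Ω)`. -/
def IsDirichletSolution {N : ℕ} (p : ℝ≥0∞) (ε : ℝ) (Ω : Set (EuclideanSpace ℝ (Fin N)))
    (g u : EuclideanSpace ℝ (Fin N) → ℝ) : Prop :=
  ContinuousOn u (closure Ω) ∧ (∀ x ∈ Ω, u x = muEps p ε Ω u x) ∧
    ∀ x ∈ frontier Ω, u x = g x

section PMean

variable {N : ℕ} {p : ℝ≥0∞} {μ : Measure (EuclideanSpace ℝ (Fin N))}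
  {v : EuclideanSpace ℝ (Fin N) → ℝ}

theorem IsPMean.of_affine {a c m : ℝ} (hc : c ≠ 0)
    (h : IsPMean p μ (fun x => a + c * v x) m) : IsPMean p μ v ((m - a) / c) := by
  intro ν
  have key : ∀ t : ℝ, eLpNorm (fun x => a + c * v x - (a + c * t)) p μ
      = ‖c‖ₑ * eLpNorm (fun x => v x - t) p μ := by
    intro t
    rw [← eLpNorm_const_smul]
    congr 1
    ext x
    simp only [Pi.smul_apply, smul_eq_mul]
    ring
  have h1 := h (a + c * ν)
  have hm : m = a + c * ((m - a) / c) := by field_simp; ring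
  rw [hm, key, key] at h1
  rw [hm]
  have h2 : a + c * ((m - a) / c) - a = c * ((m - a) / c) := by ring
  rw [h2, mul_div_cancel_left₀ _ hc]
  exact (ENNReal.mul_le_mul_iff_right (by simpa using hc) enorm_ne_top).1 h1

/-- An affine change of the values transforms the unique `p`-mean accordingly. -/
theorem pMean_affine (a : ℝ) {c : ℝ} (hc : c ≠ 0) (h : ∃! m, IsPMean p μ v m) :
    pMean p μ (fun x => a + c * v x) = a + c * pMean p μ v := by
  obtain ⟨m, hm, huniq⟩ := h
  have hv : pMean p μ v = m := huniq _ (Classical.epsilon_spec ⟨m, hm⟩)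
  have hex : IsPMean p μ (fun x => a + c * v x) (a + c * m) := by
    have hm' : IsPMean p μ (fun x => -a / c + c⁻¹ * (a + c * v x)) m := by
      convert hm using 2
      field_simp
      ring
    convert hm'.of_affine (inv_ne_zero hc) using 1
    field_simp
    ring
  have hs : IsPMean p μ (fun x => a + c * v x) (pMean p μ (fun x => a + c * v x)) :=
    Classical.epsilon_spec ⟨_, hex⟩
  have h1 := huniq _ (hs.of_affine hc)
  rw [hv, ← h1]
  field_simp
  ring

theorem exists_isPMean [IsFiniteMeasure μ] (hμ : μ ≠ 0) (hp : 1 ≤ p) (hv : MemLp v p μ) :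
    ∃ m, IsPMean p μ v m := by
  have hp0 : p ≠ 0 := (zero_lt_one.trans_le hp).ne'
  have hmem : ∀ t : ℝ, MemLp (fun x => v x - t) p μ := fun t => hv.sub (memLp_const t)
  have hone : MemLp (fun _ : EuclideanSpace ℝ (Fin N) => (1 : ℝ)) p μ := memLp_const 1
  set K := (eLpNorm (fun _ : EuclideanSpace ℝ (Fin N) => (1 : ℝ)) p μ).toReal with hK
  have hKpos : 0 < K := by
    refine ENNReal.toReal_pos ?_ hone.eLpNorm_ne_top
    rw [eLpNorm_const _ hp0 hμ]
    simp only [enorm_one, one_mul, ne_eq, ENNReal.rpow_eq_zero_iff, not_or, not_and]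
    refine ⟨fun h => absurd h (by simpa using hμ), fun h => absurd h (measure_ne_top _ _)⟩
  have hconst : ∀ t : ℝ,
      (eLpNorm (fun _ : EuclideanSpace ℝ (Fin N) => t) p μ).toReal = |t| * K := by
    intro t
    have : (fun _ : EuclideanSpace ℝ (Fin N) => t)
        = t • (fun _ : EuclideanSpace ℝ (Fin N) => (1 : ℝ)) := by
      ext; simp
    rw [this, eLpNorm_const_smul, ENNReal.toReal_mul]
    simp [K]
  set F : ℝ → ℝ := fun t => (eLpNorm (fun x => v x - t) p μ).toReal with hF
  have htri : ∀ a b : ℝ, F a ≤ F b + |a - b| * K := by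
    intro a b
    rw [← abs_sub_comm b a, ← hconst, hF, ← ENNReal.toReal_add (hmem b).eLpNorm_ne_top
      (memLp_const _).eLpNorm_ne_top]
    refine ENNReal.toReal_mono (ENNReal.add_ne_top.2 ⟨(hmem b).eLpNorm_ne_top,
      (memLp_const _).eLpNorm_ne_top⟩) ?_
    have : (fun x => v x - a) = (fun x => v x - b) + fun _ => b - a := by
      ext; simp
    rw [this]
    exact eLpNorm_add_le (hmem b).1 (memLp_const (p := p) _).1 hp
  have hcoer : ∀ t : ℝ, |t| * K - F 0 ≤ F t := by
    intro t
    rw [sub_le_iff_le_add, ← hconst, hF, ← ENNReal.toReal_add (hmem t).eLpNorm_ne_top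
      (hmem 0).eLpNorm_ne_top]
    refine ENNReal.toReal_mono (ENNReal.add_ne_top.2 ⟨(hmem t).eLpNorm_ne_top,
      (hmem 0).eLpNorm_ne_top⟩) ?_
    have : (fun _ : EuclideanSpace ℝ (Fin N) => t)
        = (fun x => v x - 0) - (fun x => v x - t) := by
      ext; simp
    rw [this, add_comm]
    exact eLpNorm_sub_le (hmem 0).1 (hmem t).1 hp
  have hcont : Continuous F := by
    refine (LipschitzWith.of_dist_le_mul (K := K.toNNReal) fun a b => ?_).continuous
    rw [Real.coe_toNNReal _ hKpos.le, Real.dist_eq, Real.dist_eq, abs_le]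
    have h1 := htri a b
    have h2 := htri b a
    rw [abs_sub_comm b a] at h2
    constructor <;> nlinarith
  have htend : Tendsto F (cocompact ℝ) atTop := by
    refine tendsto_atTop_mono hcoer ?_
    refine tendsto_atTop_add_const_right _ _ ?_
    exact (tendsto_norm_cocompact_atTop (E := ℝ)).atTop_mul_const hKpos
  obtain ⟨m, hm⟩ := hcont.exists_forall_le htend
  exact ⟨m, fun ν => (ENNReal.toReal_le_toReal (hmem m).eLpNorm_ne_top
    (hmem ν).eLpNorm_ne_top).1 (hm ν)⟩

theorem IsPMean.le_of_isPMean_top (hμ : μ ≠ 0) (hv : MemLp v ∞ μ) {a b : ℝ}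
    (ha : IsPMean ∞ μ v a) (hb : IsPMean ∞ μ v b) : b ≤ a := by
  by_contra! hab
  have : NeZero μ := ⟨hμ⟩
  have key : ∀ t : ℝ, IsPMean ∞ μ v t →
      ∀ᵐ x ∂μ, |v x - t| ≤ (eLpNorm (fun x => v x - a) ∞ μ).toReal := by
    intro t ht
    have hae := ae_le_eLpNormEssSup (f := fun x => v x - t) (μ := μ)
    have hle := ht a
    have hfin : eLpNorm (fun x => v x - a) ∞ μ ≠ ∞ := by
      refine ne_top_of_le_ne_top ?_ (ha 0)
      simpa using hv.eLpNorm_ne_top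
    filter_upwards [hae] with x hx
    rw [← eLpNorm_exponent_top] at hx
    have := ENNReal.toReal_mono hfin (hx.trans hle)
    simpa using this
  set d := (eLpNorm (fun x => v x - a) ∞ μ).toReal with hd
  have hmid : ∀ᵐ x ∂μ, ‖v x - (a + b) / 2‖ ≤ d - (b - a) / 2 := by
    filter_upwards [key a ha, key b hb] with x hx hy
    rw [abs_le] at hx hy
    rw [Real.norm_eq_abs, abs_le]
    constructor <;> linarith
  obtain ⟨x, hx⟩ := hmid.exists
  have hpos : 0 ≤ d - (b - a) / 2 := (norm_nonneg _).trans hx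
  have h1 := eLpNormEssSup_le_of_ae_bound hmid
  rw [← eLpNorm_exponent_top] at h1
  have h2 := ENNReal.toReal_mono ENNReal.ofReal_ne_top ((ha ((a + b) / 2)).trans h1)
  rw [ENNReal.toReal_ofReal hpos] at h2
  linarith

theorem setIntegral_lt_setIntegral_of_isOpen {s : Set (EuclideanSpace ℝ (Fin N))}
    (hs : IsOpen s) {f h : EuclideanSpace ℝ (Fin N) → ℝ}
    (hf : ContinuousOn f s) (hh : ContinuousOn h s)
    (hfi : IntegrableOn f s) (hhi : IntegrableOn h s) (hle : ∀ x ∈ s, f x ≤ h x)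
    (hlt : ∃ x ∈ s, f x < h x) : ∫ x in s, f x < ∫ x in s, h x := by
  obtain ⟨x, hx, hfx⟩ := hlt
  rw [← sub_pos, ← integral_sub hhi hfi]
  rw [setIntegral_pos_iff_support_of_nonneg_ae]
  · have hopen : IsOpen (s ∩ (fun y => h y - f y) ⁻¹' Set.Ioi 0) :=
      (hh.sub hf).isOpen_inter_preimage hs isOpen_Ioi
    refine (hopen.measure_pos volume ⟨x, hx, sub_pos.2 hfx⟩).trans_le (measure_mono ?_)
    rintro y ⟨hys, hy⟩
    exact ⟨ne_of_gt hy, hys⟩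
  · filter_upwards [ae_restrict_mem hs.measurableSet] with y hy
    simpa using hle y hy
  · exact hhi.sub hfi

theorem abs_sub_midpoint_rpow_le {q : ℝ} (hq : 1 ≤ q) (t a b : ℝ) :
    |t - (a + b) / 2| ^ q ≤ (|t - a| ^ q + |t - b| ^ q) / 2 := by
  have h1 : |t - (a + b) / 2| ≤ (1 / 2 : ℝ) * |t - a| + (1 / 2 : ℝ) * |t - b| := by
    have := abs_add_le ((t - a) / 2) ((t - b) / 2)
    rw [abs_div, abs_div, abs_two] at this
    have h : (t - a) / 2 + (t - b) / 2 = t - (a + b) / 2 := by ring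
    rw [h] at this
    linarith
  have h2 := (convexOn_rpow hq).2 (abs_nonneg (t - a)) (abs_nonneg (t - b))
    (by norm_num : (0 : ℝ) ≤ 1 / 2) (by norm_num : (0 : ℝ) ≤ 1 / 2) (by norm_num)
  simp only [smul_eq_mul] at h2
  have h3 := Real.rpow_le_rpow (abs_nonneg _) h1 (by linarith : 0 ≤ q)
  linarith

theorem abs_sub_midpoint_rpow_lt {q : ℝ} (hq : 1 ≤ q) {t a b : ℝ} (ha : a < t) (hb : t < b) :
    |t - (a + b) / 2| ^ q < (|t - a| ^ q + |t - b| ^ q) / 2 := by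
  have h1 : |t - (a + b) / 2| < (1 / 2 : ℝ) * |t - a| + (1 / 2 : ℝ) * |t - b| := by
    rw [abs_of_pos (sub_pos.2 ha), abs_of_neg (sub_neg.2 hb), abs_lt]
    constructor <;> linarith
  have h2 := (convexOn_rpow hq).2 (abs_nonneg (t - a)) (abs_nonneg (t - b))
    (by norm_num : (0 : ℝ) ≤ 1 / 2) (by norm_num : (0 : ℝ) ≤ 1 / 2) (by norm_num)
  simp only [smul_eq_mul] at h2
  have h3 := Real.rpow_lt_rpow (abs_nonneg _) h1 (by linarith : 0 < q)
  linarith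

/-- For finite `p`, two `p`-means on a connected open set of a continuous function coincide.
Connectedness is needed for `p = 1`. -/
theorem IsPMean.le_of_isPMean {s : Set (EuclideanSpace ℝ (Fin N))} (hs : IsOpen s)
    (hsc : IsPreconnected s) (hsn : s.Nonempty) [IsFiniteMeasure (volume.restrict s)]
    (hp : 1 ≤ p) (hp' : p ≠ ∞) (hv : ContinuousOn v s) (hvp : MemLp v p (volume.restrict s))
    {a b : ℝ} (ha : IsPMean p (volume.restrict s) v a)
    (hb : IsPMean p (volume.restrict s) v b) : b ≤ a := by
  by_contra! hab
  have hp0 : p ≠ 0 := (zero_lt_one.trans_le hp).ne'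
  have hq : 1 ≤ p.toReal := by
    simpa using ENNReal.toReal_mono hp' hp
  have hq0 : 0 < p.toReal := zero_lt_one.trans_le hq
  have hmem : ∀ t : ℝ, MemLp (fun x => v x - t) p (volume.restrict s) :=
    fun t => hvp.sub (memLp_const t)
  have hint : ∀ t : ℝ, IntegrableOn (fun x => |v x - t| ^ p.toReal) s :=
    fun t => (hmem t).integrable_norm_rpow hp0 hp'
  have hcont : ∀ t : ℝ, ContinuousOn (fun x => |v x - t| ^ p.toReal) s :=
    fun t => ((hv.sub continuousOn_const).abs).rpow_const fun _ _ => Or.inr hq0.le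
  have hmin : ∀ m : ℝ, IsPMean p (volume.restrict s) v m → ∀ t : ℝ,
      ∫ x in s, |v x - m| ^ p.toReal ≤ ∫ x in s, |v x - t| ^ p.toReal := by
    intro m hm t
    have h := hm t
    have hnn : ∀ t : ℝ, 0 ≤ ∫ x in s, |v x - t| ^ p.toReal :=
      fun t => integral_nonneg fun x => by positivity
    rw [(hmem m).eLpNorm_eq_integral_rpow_norm hp0 hp',
      (hmem t).eLpNorm_eq_integral_rpow_norm hp0 hp'] at h
    simp only [Real.norm_eq_abs] at h
    rw [ENNReal.ofReal_le_ofReal_iff (Real.rpow_nonneg (hnn t) _)] at h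
    exact (Real.rpow_le_rpow_iff (hnn m) (hnn t) (inv_pos.2 hq0)).1 h
  by_cases hmid : ∃ x ∈ s, a < v x ∧ v x < b
  · obtain ⟨x, hx, hax, hxb⟩ := hmid
    have h := setIntegral_lt_setIntegral_of_isOpen hs (hcont ((a + b) / 2))
      (((hcont a).add (hcont b)).div_const 2) (hint _) (((hint a).add (hint b)).div_const 2)
      (fun y _ => abs_sub_midpoint_rpow_le hq _ _ _)
      ⟨x, hx, abs_sub_midpoint_rpow_lt hq hax hxb⟩
    simp only [Pi.add_apply] at h
    rw [integral_div, integral_add (hint a) (hint b)] at h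
    have h1 := hmin a ha ((a + b) / 2)
    have h2 := hmin b hb ((a + b) / 2)
    linarith
  · push Not at hmid
    obtain ⟨y, hy⟩ := hsn
    have hmid' : ∀ x ∈ s, v x ≤ a ∨ b ≤ v x := fun x hx => by
      rcases le_or_gt (v x) a with h | h
      · exact Or.inl h
      · exact Or.inr (hmid x hx h)
    have himg : (v '' s).OrdConnected := (hsc.image v hv).ordConnected
    have hside : (∀ x ∈ s, v x ≤ a) ∨ ∀ x ∈ s, b ≤ v x := by
      by_contra! h
      obtain ⟨⟨x, hx, hax⟩, x', hx', hxb⟩ := h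
      have hbx : b ≤ v x := hmid x hx hax
      have hxa : v x' ≤ a := (hmid' x' hx').resolve_right (not_le.2 hxb)
      obtain ⟨w, hw, hwe⟩ := himg.out (Set.mem_image_of_mem v hx') (Set.mem_image_of_mem v hx)
        (show (a + b) / 2 ∈ Set.Icc (v x') (v x) from ⟨by linarith, by linarith⟩)
      rcases hmid' w hw with h | h <;> linarith
    rcases hside with h | h
    · have hlt : ∀ x ∈ s, |v x - a| ^ p.toReal < |v x - b| ^ p.toReal := fun x hx => by
        refine Real.rpow_lt_rpow (abs_nonneg _) ?_ hq0
        have := h x hx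
        rw [abs_of_nonpos (by linarith), abs_of_nonpos (by linarith)]
        linarith
      exact absurd (hmin b hb a) (not_le.2 (setIntegral_lt_setIntegral_of_isOpen hs (hcont a)
        (hcont b) (hint a) (hint b) (fun x hx => (hlt x hx).le) ⟨y, hy, hlt y hy⟩))
    · have hlt : ∀ x ∈ s, |v x - b| ^ p.toReal < |v x - a| ^ p.toReal := fun x hx => by
        refine Real.rpow_lt_rpow (abs_nonneg _) ?_ hq0
        have := h x hx
        rw [abs_of_nonneg (by linarith), abs_of_nonneg (by linarith)]
        linarith
      exact absurd (hmin a ha b) (not_le.2 (setIntegral_lt_setIntegral_of_isOpen hs (hcont b)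
        (hcont a) (hint b) (hint a) (fun x hx => (hlt x hx).le) ⟨y, hy, hlt y hy⟩))

/-- The `p`-mean of a bounded continuous function on a connected open set of finite measure
exists and is unique. -/
theorem existsUnique_isPMean {s : Set (EuclideanSpace ℝ (Fin N))} (hs : IsOpen s)
    (hsc : IsPreconnected s) (hsn : s.Nonempty) [IsFiniteMeasure (volume.restrict s)]
    (hp : 1 ≤ p) (hv : ContinuousOn v s) {C : ℝ} (hC : ∀ x ∈ s, |v x| ≤ C) :
    ∃! m, IsPMean p (volume.restrict s) v m := by
  have hvp : MemLp v p (volume.restrict s) :=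
    MemLp.of_bound (hv.aestronglyMeasurable hs.measurableSet) C
      (by filter_upwards [ae_restrict_mem hs.measurableSet] with x hx using hC x hx)
  have hμ : volume.restrict s ≠ 0 := by
    rw [Ne, Measure.restrict_eq_zero]
    exact (hs.measure_pos volume hsn).ne'
  obtain ⟨m, hm⟩ := exists_isPMean hμ hp hvp
  refine ⟨m, hm, fun m' hm' => ?_⟩
  rcases eq_or_ne p ∞ with rfl | hp'
  · exact le_antisymm (hm.le_of_isPMean_top hμ hvp hm') (hm'.le_of_isPMean_top hμ hvp hm)
  · exact le_antisymm (hm.le_of_isPMean hs hsc hsn hp hp' hv hvp hm')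
      (hm'.le_of_isPMean hs hsc hsn hp hp' hv hvp hm)

theorem ball_rEps_subset {ε : ℝ} {Ω : Set (EuclideanSpace ℝ (Fin N))}
    {x : EuclideanSpace ℝ (Fin N)} (hx : x ∈ Ω) : ball x (rEps ε Ω x) ⊆ Ω := by
  rcases le_or_gt (rEps ε Ω x) 0 with h | h
  · rw [ball_eq_empty.2 h]
    exact Set.empty_subset _
  have hdisj : ∀ y ∈ ball x (rEps ε Ω x), y ∉ frontier Ω := fun y hy hyf => by
    have h1 := infDist_le_dist_of_mem (x := x) hyf
    have h2 : dist x y < rEps ε Ω x := by rwa [dist_comm]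
    exact absurd (h1.trans_lt h2) (not_lt.2 (min_le_right _ _))
  have hconn : IsPreconnected (ball x (rEps ε Ω x)) := (convex_ball x _).isPreconnected
  have hxi : x ∈ interior Ω := by
    by_contra hxi
    exact hdisj x (mem_ball_self h) ⟨subset_closure hx, hxi⟩
  refine (hconn.subset_left_of_subset_union isOpen_interior isClosed_closure.isOpen_compl
    (disjoint_compl_right.mono_left interior_subset_closure) (fun y hy => ?_)
    ⟨x, mem_ball_self h, hxi⟩).trans interior_subset
  by_contra hy'
  rw [Set.mem_union, not_or, Set.notMem_compl_iff] at hy'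
  exact hdisj y hy ⟨hy'.2, hy'.1⟩

theorem muEps_affine (hp : 1 ≤ p) {ε : ℝ} (hε : 0 < ε) {Ω : Set (EuclideanSpace ℝ (Fin N))}
    (hΩo : IsOpen Ω) (hΩb : Bornology.IsBounded Ω) (hΓ : (frontier Ω).Nonempty)
    (hv : ContinuousOn v (closure Ω)) (a : ℝ) {c : ℝ} (hc : c ≠ 0)
    {x : EuclideanSpace ℝ (Fin N)} (hx : x ∈ Ω) :
    muEps p ε Ω (fun y => a + c * v y) x = a + c * muEps p ε Ω v x := by
  have hr : 0 < rEps ε Ω x := by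
    refine lt_min hε ((isClosed_frontier.notMem_iff_infDist_pos hΓ).1 fun hxf => ?_)
    exact (hΩo.inter_frontier_eq ▸ (⟨hx, hxf⟩ : x ∈ Ω ∩ frontier Ω) : x ∈ (∅ : Set _))
  have hsub : ball x (rEps ε Ω x) ⊆ closure Ω := (ball_rEps_subset hx).trans subset_closure
  obtain ⟨C, hC⟩ := hΩb.isCompact_closure.exists_bound_of_continuousOn hv
  have : IsFiniteMeasure (volume.restrict (ball x (rEps ε Ω x))) :=
    ⟨by simpa using measure_ball_lt_top⟩
  simp only [muEps, if_pos hx]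
  exact pMean_affine a hc (existsUnique_isPMean isOpen_ball (convex_ball x _).isPreconnected
    (nonempty_ball.2 hr) hp (hv.mono hsub) fun y hy => hC y (hsub hy))

end PMean

/-- A function continuous on a compact set and a nonnegative function vanishing at most at
`x₀`: a large multiple of the latter controls the oscillation of the former at `x₀`. -/
theorem exists_abs_sub_le_add_mul {X : Type*} [TopologicalSpace X] {K : Set X}
    (hK : IsCompact K) {g w : X → ℝ} (hg : ContinuousOn g K) (hw : ContinuousOn w K) {x₀ : X}
    (hx₀ : x₀ ∈ K) (hpos : ∀ x ∈ K, x ≠ x₀ → 0 < w x) (hw₀ : w x₀ = 0) {δ : ℝ} (hδ : 0 < δ) :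
    ∃ C > 0, ∀ x ∈ K, |g x - g x₀| ≤ δ + C * w x := by
  have hwnn : ∀ x ∈ K, 0 ≤ w x := fun x hx => by
    rcases eq_or_ne x x₀ with rfl | h
    · exact hw₀.ge
    · exact (hpos x hx h).le
  have hcont := hg.continuousWithinAt hx₀
  obtain ⟨U, hUo, hxU, hU⟩ := mem_nhdsWithin.1 (hcont (ball_mem_nhds (g x₀) hδ))
  have hL : IsCompact (K \ U) := hK.diff hUo
  have hne : ∀ x ∈ K \ U, 0 < w x := fun x hx => hpos x hx.1 fun h => hx.2 (h ▸ hxU)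
  have hq : ContinuousOn (fun x => (g x - g x₀) / w x) (K \ U) :=
    ((hg.mono Set.sdiff_subset).sub continuousOn_const).div (hw.mono Set.sdiff_subset)
      fun x hx => (hne x hx).ne'
  obtain ⟨C, hC⟩ := hL.exists_bound_of_continuousOn hq
  refine ⟨max C 1, by positivity, fun x hx => ?_⟩
  have hCw : 0 ≤ max C 1 * w x := mul_nonneg (by positivity) (hwnn x hx)
  by_cases hxU' : x ∈ U
  · have h : dist (g x) (g x₀) < δ := hU ⟨hxU', hx⟩
    rw [Real.dist_eq] at h
    linarith
  · have hwx := hne x ⟨hx, hxU'⟩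
    have h := hC x ⟨hx, hxU'⟩
    rw [norm_div, Real.norm_eq_abs, Real.norm_eq_abs, abs_of_pos hwx, div_le_iff₀ hwx] at h
    have := mul_le_mul_of_nonneg_right (le_max_left C 1) hwx.le
    linarith

/-- Proposition 4.5: if `x₀ ∈ Γ` is a regular point (i.e. it admits a
barrier), then the lower and upper Perron solutions attain the boundary datum at `x₀`. -/
theorem perron_attains_boundary_value {N : ℕ} (hN : 0 < N) (p : ℝ≥0∞) (hp : 1 ≤ p)
    (Ω : Set (EuclideanSpace ℝ (Fin N))) (hΩo : IsOpen Ω) (hΩc : IsPreconnected Ω)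
    (hΩb : Bornology.IsBounded Ω) (hΩne : Ω.Nonempty)
    (ε : ℝ) (hε : 0 < ε) (z : EuclideanSpace ℝ (Fin N)) (hball : Metric.ball z ε ⊆ Ω)
    (g : EuclideanSpace ℝ (Fin N) → ℝ) (hg : ContinuousOn g (frontier Ω))
    (x₀ : EuclideanSpace ℝ (Fin N)) (hx₀ : x₀ ∈ frontier Ω)
    (hreg : ∃ w, IsBarrier p ε Ω x₀ w) :
    lowerPerron p ε Ω g x₀ = g x₀ ∧ upperPerron p ε Ω g x₀ = g x₀ := by
  obtain ⟨w, hwc, hws, hwpos, hw₀⟩ := hreg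
  have hsub : frontier Ω ⊆ closure Ω := frontier_subset_closure
  have hK : IsCompact (frontier Ω) := hΩb.isCompact_closure.of_isClosed_subset
    isClosed_frontier hsub
  have hμ := fun (a c : ℝ) (hc : c ≠ 0) x (hx : x ∈ Ω) =>
    muEps_affine hp hε hΩo hΩb ⟨x₀, hx₀⟩ hwc a hc hx
  have hcmp := fun (δ : ℝ) (hδ : 0 < δ) => exists_abs_sub_le_add_mul hK hg (hwc.mono hsub) hx₀
    (fun x hx => hwpos x (hsub hx)) hw₀ hδ
  have hlow : ∀ δ > 0, g x₀ - δ ∈ (fun v => v x₀) '' SgLower p ε Ω g := by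
    intro δ hδ
    obtain ⟨C, hC, hCg⟩ := hcmp δ hδ
    refine ⟨fun x => (g x₀ - δ) + (-C) * w x,
      ⟨continuousOn_const.add (continuousOn_const.mul hwc), fun x hx => ?_, fun x hx => ?_⟩,
      by simp [hw₀]⟩
    · rw [hμ _ _ (neg_ne_zero.2 hC.ne') x hx]
      have := mul_le_mul_of_nonneg_left (hws x hx) hC.le
      linarith
    · have := (abs_le.1 (hCg x hx)).1
      linarith
  have hupp : ∀ δ > 0, g x₀ + δ ∈ (fun v => v x₀) '' SgUpper p ε Ω g := by
    intro δ hδ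
    obtain ⟨C, hC, hCg⟩ := hcmp δ hδ
    refine ⟨fun x => (g x₀ + δ) + C * w x,
      ⟨continuousOn_const.add (continuousOn_const.mul hwc), fun x hx => ?_, fun x hx => ?_⟩,
      by simp [hw₀]⟩
    · rw [hμ _ _ hC.ne' x hx]
      have := mul_le_mul_of_nonneg_left (hws x hx) hC.le
      linarith
    · have := (abs_le.1 (hCg x hx)).2
      linarith
  constructor
  · refine csSup_eq_of_forall_le_of_forall_lt_exists_gt ⟨_, hlow 1 one_pos⟩ ?_ fun b hb =>
      ⟨_, hlow ((g x₀ - b) / 2) (by linarith), by linarith⟩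
    rintro _ ⟨v, hv, rfl⟩
    exact hv.2.2 x₀ hx₀
  · refine csInf_eq_of_forall_ge_of_forall_gt_exists_lt ⟨_, hupp 1 one_pos⟩ ?_ fun b hb =>
      ⟨_, hupp ((b - g x₀) / 2) (by linarith), by linarith⟩
    rintro _ ⟨v, hv, rfl⟩
    exact hv.2.2 x₀ hx₀
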